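/- The model checking problem for HyperQCTL* is undecidable: there is no algorithm that, given a finite Kripke structure K and a HyperQCTL* sentence φ, decides whether K ⊨ φ. -/

import Mathlib

/-!
STATEMENT 4: The model checking problem for HyperQCTL* is undecidable: there
is no algorithm that, given a finite Kripke structure K and a HyperQCTL*
sentence φ, decides whether K ⊨ φ.
-/

/-- A finite Kripke structure: finitely many states `Fin n`, an initial state,
a transition function with nonempty successor sets, and a state labeling. -/
structure FinKripke where
  n : ℕ
  init : Fin n
  trans : Fin n → Finset (Fin n)
  trans_nonempty : ∀ s, (trans s).Nonempty
  label : Fin n → Finset ℕ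

/-- Paths of `K` starting in state `s`. -/
def FinKripke.PathFrom (K : FinKripke) (s : Fin K.n) (p : ℕ → Fin K.n) : Prop :=
  p 0 = s ∧ ∀ i, p (i + 1) ∈ K.trans (p i)

/-- The labeling of `K` extended to finite state sequences (evaluating the
last state). -/
def FinKripke.seqLabel (K : FinKripke) (l : List (Fin K.n)) : Set ℕ :=
  match l.getLast? with
  | some s => ((K.label s : Finset ℕ) : Set ℕ)
  | none => ∅

/-- HyperQCTL* formulas: `a_π | ¬φ | φ ∨ φ | X φ | φ U φ | ∃π.φ | ∃q.φ`. -/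
inductive HQC : Type
  | atom : ℕ → ℕ → HQC           -- `a_π` (proposition, path variable)
  | not : HQC → HQC
  | or : HQC → HQC → HQC
  | next : HQC → HQC
  | xuntil : HQC → HQC → HQC
  | ex : ℕ → HQC → HQC           -- `∃π.φ`
  | pex : ℕ → HQC → HQC          -- `∃q.φ` (propositional quantification)

/-- Satisfaction `K, Π, i ⊨ φ` of a HyperQCTL* formula: `L` is the current
labeling `S* → 2^AP` of the computation tree (initially the labeling of `K`),
`Pi` assigns path variables to paths of `K`, and `cur` is the most recently
quantified path. A propositional quantifier `∃q.φ` introduces a fresh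
labeling `L'` that agrees with `L` on all propositions other than `q`. -/
def HQC.Sat (K : FinKripke) :
    (List (Fin K.n) → Set ℕ) → (ℕ → (ℕ → Fin K.n)) → (ℕ → Fin K.n) → ℕ →
      HQC → Prop
  | L, Pi, _, i, .atom a π => a ∈ L ((List.range (i + 1)).map (Pi π))
  | L, Pi, cur, i, .not φ => ¬ HQC.Sat K L Pi cur i φ
  | L, Pi, cur, i, .or φ₁ φ₂ =>
      HQC.Sat K L Pi cur i φ₁ ∨ HQC.Sat K L Pi cur i φ₂
  | L, Pi, cur, i, .next φ => HQC.Sat K L Pi cur (i + 1) φ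
  | L, Pi, cur, i, .xuntil φ₁ φ₂ =>
      ∃ k, i ≤ k ∧ HQC.Sat K L Pi cur k φ₂ ∧
        ∀ j, i ≤ j → j < k → HQC.Sat K L Pi cur j φ₁
  | L, Pi, cur, i, .ex π φ =>
      ∃ p : ℕ → Fin K.n, K.PathFrom (cur i) p ∧
        HQC.Sat K L (Function.update Pi π p) p i φ
  | L, Pi, cur, i, .pex q φ =>
      ∃ L' : List (Fin K.n) → Set ℕ,
        (∀ w, ∀ b, b ≠ q → (b ∈ L' w ↔ b ∈ L w)) ∧
        HQC.Sat K L' Pi cur i φ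

/-- Free path variables of a HyperQCTL* formula. -/
def HQC.free : HQC → Finset ℕ
  | .atom _ π => {π}
  | .not φ => φ.free
  | .or φ₁ φ₂ => φ₁.free ∪ φ₂.free
  | .next φ => φ.free
  | .xuntil φ₁ φ₂ => φ₁.free ∪ φ₂.free
  | .ex π φ => φ.free \ {π}
  | .pex _ φ => φ.free

/-- Temporal operators occur only inside the scope of path quantifiers. -/
def HQC.Guarded : HQC → Bool → Prop
  | .atom _ _, _ => True
  | .not φ, b => HQC.Guarded φ b
  | .or φ₁ φ₂, b => HQC.Guarded φ₁ b ∧ HQC.Guarded φ₂ b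
  | .next φ, b => b = true ∧ HQC.Guarded φ b
  | .xuntil φ₁ φ₂, b => b = true ∧ HQC.Guarded φ₁ b ∧ HQC.Guarded φ₂ b
  | .ex _ φ, _ => HQC.Guarded φ true
  | .pex _ φ, b => HQC.Guarded φ b

/-- A HyperQCTL* sentence. -/
def HQC.Sentence (φ : HQC) : Prop := φ.free = ∅ ∧ φ.Guarded false

/-- `K ⊨ φ` iff `K, ∅, 0 ⊨ φ` with the original labeling of `K`. -/
def FinKripke.Models (K : FinKripke) (φ : HQC) : Prop :=
  HQC.Sat K K.seqLabel (fun _ _ => K.init) (fun _ => K.init) 0 φ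

/-- An explicit (injective) numerical encoding of HyperQCTL* formulas. -/
def HQC.enc : HQC → ℕ
  | .atom a π => Nat.pair 0 (Nat.pair a π)
  | .not φ => Nat.pair 1 φ.enc
  | .or φ₁ φ₂ => Nat.pair 2 (Nat.pair φ₁.enc φ₂.enc)
  | .next φ => Nat.pair 3 φ.enc
  | .xuntil φ₁ φ₂ => Nat.pair 4 (Nat.pair φ₁.enc φ₂.enc)
  | .ex π φ => Nat.pair 5 (Nat.pair π φ.enc)
  | .pex q φ => Nat.pair 6 (Nat.pair q φ.enc)

/-- An explicit (injective) numerical encoding of finite Kripke structures. -/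
def FinKripke.enc (K : FinKripke) : ℕ :=
  Nat.pair K.n (Nat.pair K.init.val (Nat.pair
    (Encodable.encode
      ((List.finRange K.n).map fun s => ((K.trans s).sort (· ≤ ·)).map Fin.val))
    (Encodable.encode
      ((List.finRange K.n).map fun s => (K.label s).sort (· ≤ ·)))))

namespace HQCU

/-- The two-state comb structure `0 → {0,1}`, `1 → {1}`. -/
@[reducible] def K0 : FinKripke where
  n := 2
  init := (0 : Fin 2)
  trans := fun s : Fin 2 => if s = 0 then ({0, 1} : Finset (Fin 2)) else ({1} : Finset (Fin 2))
  trans_nonempty := by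
    intro s
    by_cases h : s = (0 : Fin 2)
    · exact ⟨(0 : Fin 2), by simp [h]⟩
    · exact ⟨(1 : Fin 2), by simp [h]⟩
  label := fun s : Fin 2 => if s = 1 then ({0} : Finset ℕ) else ∅

/-- The path coding the number `n`. -/
def num (n : ℕ) : ℕ → Fin 2 := fun t => if t ≤ n then 0 else 1

theorem num_one {n t : ℕ} : num n t = 1 ↔ n < t := by
  unfold num; split <;> simp <;> omega

theorem num_zero_zero (n : ℕ) : num n 0 = 0 := by simp [num]

abbrev Lab := List (Fin 2) → Set ℕ

abbrev node (x t : ℕ) : List (Fin 2) := (List.range (t + 1)).map (num x)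

def Good (L : Lab) : Prop :=
  ∀ (p : ℕ → Fin 2) (i : ℕ), 0 ∈ L ((List.range (i + 1)).map p) ↔ p i = 1

def relOf (L : Lab) (x y : ℕ) : Prop :=
  (x < y ∧ 1 ∈ L (node x y)) ∨ (y ≤ x ∧ 2 ∈ L (node y (x + 1)))

abbrev Rel := ℕ → ℕ → Prop

theorem node_inj {x t x' t' : ℕ} (h : x < t) (h' : x' < t') (e : node x t = node x' t') :
    x = x' ∧ t = t' := by
  have hl := congrArg List.length e
  simp at hl
  subst hl
  refine ⟨?_, rfl⟩
  have key : ∀ s, s ≤ t → num x s = num x' s := by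
    intro s hs
    have := congrArg (fun l => l[s]?) e
    simpa [node, List.getElem?_range (show s < t + 1 by omega)] using this
  rcases lt_trichotomy x x' with h1 | h1 | h1
  · have := key (x + 1) (by omega)
    have h2 : num x (x+1) = 1 := num_one.2 (by omega)
    rw [h2] at this
    have := num_one.1 this.symm
    omega
  · exact h1
  · have := key (x' + 1) (by omega)
    have h2 : num x' (x'+1) = 1 := num_one.2 (by omega)
    rw [h2] at this
    have := num_one.1 this
    omega

/-! Formula abbreviations -/
def fand (a b : HQC) : HQC := .not (.or (.not a) (.not b))
def fF (a : HQC) : HQC := .xuntil (.or a (.not a)) a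
def fat (x : ℕ) : HQC := fand (.not (.atom 0 x)) (.next (.atom 0 x))

abbrev S (L : Lab) (Pi : ℕ → ℕ → Fin 2) (cur : ℕ → Fin 2) (i : ℕ) (φ : HQC) : Prop :=
  HQC.Sat K0 L Pi cur i φ

theorem sat_and {L Pi cur i a b} : S L Pi cur i (fand a b) ↔ S L Pi cur i a ∧ S L Pi cur i b := by
  simp only [S, fand, HQC.Sat]; tauto

theorem sat_F {L Pi cur i a} : S L Pi cur i (fF a) ↔ ∃ k, i ≤ k ∧ S L Pi cur k a := by
  simp only [S, fF, HQC.Sat]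
  constructor
  · rintro ⟨k, h1, h2, _⟩; exact ⟨k, h1, h2⟩
  · rintro ⟨k, h1, h2⟩; exact ⟨k, h1, h2, fun j _ _ => em _⟩

theorem sat_atom0 {L : Lab} {Pi cur i} {x n : ℕ} (hL : Good L) (hx : Pi x = num n) :
    S L Pi cur i (.atom 0 x) ↔ n < i := by
  simp only [S, HQC.Sat, hx]
  exact (hL _ _).trans num_one

theorem sat_at {L : Lab} {Pi cur i} {x n : ℕ} (hL : Good L) (hx : Pi x = num n) :
    S L Pi cur i (fat x) ↔ i = n := by
  have h1 := sat_atom0 (cur := cur) (i := i) hL hx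
  have h2 := sat_atom0 (cur := cur) (i := i + 1) hL hx
  unfold fat
  rw [sat_and]
  simp only [S, HQC.Sat] at h1 h2 ⊢
  rw [h1, h2]; omega

theorem free_and (a b : HQC) : (fand a b).free = a.free ∪ b.free := rfl
theorem free_F (a : HQC) : (fF a).free = a.free := by simp [fF, HQC.free]
theorem free_at (x : ℕ) : (fat x).free = {x} := by simp [fat, fand, HQC.free]

def Defines (φ : HQC) (P : Rel → (ℕ → ℕ) → Prop) : Prop :=
  ∀ (L : Lab) (Pi : ℕ → ℕ → Fin 2) (cur : ℕ → Fin 2) (v : ℕ → ℕ), Good L → cur 0 = 0 →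
    (∀ i ∈ φ.free, Pi i = num (v i)) → (S L Pi cur 0 φ ↔ P (relOf L) v)

def Defn (P : Rel → (ℕ → ℕ) → Prop) : Prop := ∃ φ, Defines φ P

theorem Defn.not {P} (h : Defn P) : Defn (fun R v => ¬ P R v) := by
  obtain ⟨φ, h⟩ := h
  refine ⟨.not φ, fun L Pi cur v hL hc hf => ?_⟩
  simp only [S, HQC.Sat]
  exact not_congr (h L Pi cur v hL hc hf)

theorem defines_and {P Q φ ψ} (h : Defines φ P) (h' : Defines ψ Q) :
    Defines (fand φ ψ) (fun R v => P R v ∧ Q R v) := by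
  intro L Pi cur v hL hc hf
  rw [free_and] at hf
  rw [sat_and, h L Pi cur v hL hc (fun i hi => hf i (Finset.mem_union_left _ hi)),
    h' L Pi cur v hL hc (fun i hi => hf i (Finset.mem_union_right _ hi))]

theorem Defn.and {P Q} (h : Defn P) (h' : Defn Q) : Defn (fun R v => P R v ∧ Q R v) := by
  obtain ⟨φ, h⟩ := h
  obtain ⟨ψ, h'⟩ := h'
  exact ⟨_, defines_and h h'⟩

theorem Defn.congr {P Q : Rel → (ℕ → ℕ) → Prop} (h : Defn P) (e : ∀ R v, P R v ↔ Q R v) :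
    Defn Q := by
  have : P = Q := by funext R v; exact propext (e R v)
  exact this ▸ h

theorem Defn.or {P Q} (h : Defn P) (h' : Defn Q) : Defn (fun R v => P R v ∨ Q R v) :=
  (h.not.and h'.not).not.congr (fun R v => by tauto)

theorem Defn.imp {P Q} (h : Defn P) (h' : Defn Q) : Defn (fun R v => P R v → Q R v) :=
  (h.not.or h').congr (fun R v => by tauto)

theorem num_path (n : ℕ) : K0.PathFrom (0 : Fin 2) (num n) := by
  refine ⟨num_zero_zero n, fun i => ?_⟩
  show num n (i + 1) ∈ (if num n i = 0 then ({0, 1} : Finset (Fin 2)) else {1})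
  unfold num
  by_cases h1 : i + 1 ≤ n
  · simp [h1, show i ≤ n by omega]
  · by_cases h2 : i ≤ n <;> simp [h1, h2]

theorem path_num {p : ℕ → Fin 2} (hp : K0.PathFrom (0 : Fin 2) p) (h : ∃ k, p k = 1) :
    ∃ n, p = num n := by
  classical
  obtain ⟨h0, hs⟩ := hp
  have hs' : ∀ i, p (i + 1) ∈ (if p i = 0 then ({0, 1} : Finset (Fin 2)) else {1}) := hs
  have hk := Nat.find_spec h
  have hm : ∀ m, m < Nat.find h → p m ≠ 1 := fun m hm => Nat.find_min h hm
  generalize Nat.find h = k at hk hm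
  have up : ∀ d, p (k + d) = 1 := by
    intro d
    induction d with
    | zero => exact hk
    | succ d ih =>
      have := hs' (k + d)
      rw [ih] at this
      rw [← Nat.add_assoc]
      simpa using this
  obtain _ | k := k
  · have : p 0 = (0 : Fin 2) := h0
    rw [this] at hk
    exact absurd hk (by decide)
  · refine ⟨k, funext fun t => ?_⟩
    unfold num
    split
    · have := hm t (by omega)
      revert this
      generalize p t = a
      revert a; decide
    · have := up (t - (k + 1))
      rwa [show k + 1 + (t - (k + 1)) = t by omega] at this

/-- Quantification over numbers. -/
def fex (x : ℕ) (φ : HQC) : HQC := .ex x (fand (fF (.atom 0 x)) φ)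

theorem free_fex (x : ℕ) (φ : HQC) : (fex x φ).free = φ.free \ {x} := by
  ext i
  simp [fex, HQC.free, free_and, free_F]
  tauto

theorem defines_ex {P φ} (x : ℕ) (h : Defines φ P) :
    Defines (fex x φ) (fun R v => ∃ n, P R (Function.update v x n)) := by
  intro L Pi cur v hL hc hf
  rw [free_fex] at hf
  have key : ∀ n, ∀ i ∈ φ.free, Function.update Pi x (num n) i
      = num (Function.update v x n i) := by
    intro n i hi
    by_cases hix : i = x
    · subst hix; simp
    · simp [hix, hf i (by simp [hi, hix])]
  have step : ∀ n, S L (Function.update Pi x (num n)) (num n) 0 (fand (fF (.atom 0 x)) φ) ↔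
      P (relOf L) (Function.update v x n) := by
    intro n
    rw [sat_and, h L _ _ _ hL (num_zero_zero n) (key n), sat_F]
    refine ⟨fun h => h.2, fun h => ⟨⟨n + 1, by omega, ?_⟩, h⟩⟩
    rw [sat_atom0 (n := n) hL (by simp)]
    omega
  constructor
  · rintro ⟨p, hp, hs⟩
    have hp' : K0.PathFrom (0 : Fin 2) p := by rw [← hc]; exact hp
    have h1 := sat_F.1 (sat_and.1 hs).1
    obtain ⟨k, _, hk⟩ := h1
    have hk' : p k = 1 := by
      have := (hL _ _).1 hk
      simpa using this
    obtain ⟨n, rfl⟩ := path_num hp' ⟨k, hk'⟩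
    exact ⟨n, (step n).1 hs⟩
  · rintro ⟨n, hn⟩
    refine ⟨num n, ?_, (step n).2 hn⟩
    have := num_path n
    rw [← hc] at this
    exact this

theorem Defn.ex {P} (x : ℕ) (h : Defn P) :
    Defn (fun R v => ∃ n, P R (Function.update v x n)) := by
  obtain ⟨φ, h⟩ := h
  exact ⟨_, defines_ex x h⟩

/-- Fresh-variable version of quantification: `e v` are the parameters. -/
theorem Defn.exF {α : Type} (A : Rel → α → ℕ → Prop) (e : (ℕ → ℕ) → α) (N : ℕ)
    (he : ∀ v n, e (Function.update v N n) = e v)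
    (h : Defn (fun R v => A R (e v) (v N))) : Defn (fun R v => ∃ n, A R (e v) n) :=
  (Defn.ex N h).congr (fun R v => by simp [he])

theorem Defn.allF {α : Type} (A : Rel → α → ℕ → Prop) (e : (ℕ → ℕ) → α) (N : ℕ)
    (he : ∀ v n, e (Function.update v N n) = e v)
    (h : Defn (fun R v => A R (e v) (v N))) : Defn (fun R v => ∀ n, A R (e v) n) :=
  (Defn.exF (fun R a n => ¬ A R a n) e N he h.not).not.congr (fun R v => by push Not; rfl)

/-- Quantification over binary relations. -/
theorem Defn.rex {P} (h : Defn P) : Defn (fun _ v => ∃ R, P R v) := by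
  obtain ⟨φ, h⟩ := h
  refine ⟨.pex 1 (.pex 2 φ), fun L Pi cur v hL hc hf => ?_⟩
  have hf' : ∀ i ∈ φ.free, Pi i = num (v i) := hf
  constructor
  · rintro ⟨L1, h1, L2, h2, hs⟩
    refine ⟨relOf L2, (h L2 Pi cur v ?_ hc hf').1 hs⟩
    intro p i
    exact ((h2 _ 0 (by decide)).trans (h1 _ 0 (by decide))).trans (hL p i)
  · rintro ⟨R, hR⟩
    let A : Set (List (Fin 2)) := {w | ∃ x y, x < y ∧ w = node x y ∧ R x y}
    let B : Set (List (Fin 2)) := {w | ∃ x y, y ≤ x ∧ w = node y (x + 1) ∧ R x y}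
    let L1 : Lab := fun w => {b | (b = 1 ∧ w ∈ A) ∨ (b ≠ 1 ∧ b ∈ L w)}
    let L2 : Lab := fun w => {b | (b = 2 ∧ w ∈ B) ∨ (b ≠ 2 ∧ b ∈ L1 w)}
    have hg : Good L2 := by
      intro p i
      rw [← hL p i]
      simp [L2, L1]
    have hrel : relOf L2 = R := by
      funext x y
      apply propext
      have e1 : ∀ w, 1 ∈ L2 w ↔ w ∈ A := by intro w; simp [L2, L1]
      have e2 : ∀ w, 2 ∈ L2 w ↔ w ∈ B := by intro w; simp [L2]
      unfold relOf
      rw [e1, e2]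
      constructor
      · rintro (⟨hlt, x', y', hlt', e, hr⟩ | ⟨hle, x', y', hle', e, hr⟩)
        · obtain ⟨rfl, rfl⟩ := node_inj hlt hlt' e
          exact hr
        · obtain ⟨rfl, h3⟩ := node_inj (by omega) (by omega) e
          obtain rfl : x = x' := by omega
          exact hr
      · intro hr
        rcases Nat.lt_or_ge x y with hlt | hle
        · exact Or.inl ⟨hlt, x, y, hlt, rfl, hr⟩
        · exact Or.inr ⟨hle, x, y, hle, rfl, hr⟩
    refine ⟨L1, ?_, L2, ?_, (h L2 Pi cur v hg hc hf').2 (by rw [hrel]; exact hR)⟩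
    · intro w b hb; simp [L1, hb]
    · intro w b hb; simp [L2, hb]

/-! Atoms -/

theorem d_eq (i j : ℕ) : Defn (fun _ v => v i = v j) := by
  refine ⟨fF (fand (fat i) (fat j)), fun L Pi cur v hL hc hf => ?_⟩
  simp [free_F, free_and, free_at] at hf
  simp only [sat_F, sat_and, sat_at hL hf.1, sat_at hL hf.2]
  constructor
  · rintro ⟨k, _, h1, h2⟩; omega
  · intro h; exact ⟨v i, by omega, rfl, h⟩

theorem d_succ (i j : ℕ) : Defn (fun _ v => v j = v i + 1) := by
  refine ⟨fF (fand (fat i) (.next (fat j))), fun L Pi cur v hL hc hf => ?_⟩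
  simp [free_F, free_and, free_at, HQC.free] at hf
  have hx : ∀ k, S L Pi cur k (.next (fat j)) ↔ k + 1 = v j := fun k => by
    rw [← sat_at (cur := cur) hL hf.2]; rfl
  simp only [sat_F, sat_and, sat_at hL hf.1, hx]
  constructor
  · rintro ⟨k, _, h1, h2⟩; omega
  · intro h; exact ⟨v i, by omega, rfl, h.symm⟩

theorem d_lt (i j : ℕ) : Defn (fun _ v => v i < v j) := by
  refine ⟨fF (fand (.atom 0 i) (fat j)), fun L Pi cur v hL hc hf => ?_⟩
  simp [free_F, free_and, free_at, HQC.free] at hf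
  simp only [sat_F, sat_and, sat_atom0 hL hf.1, sat_at hL hf.2]
  constructor
  · rintro ⟨k, _, h1, h2⟩; omega
  · intro h; exact ⟨v j, by omega, h, rfl⟩

theorem d_zero (i : ℕ) : Defn (fun _ v => v i = 0) := by
  refine ⟨fat i, fun L Pi cur v hL hc hf => ?_⟩
  simp [free_at] at hf
  rw [sat_at hL hf]
  exact eq_comm

theorem d_rel (i j : ℕ) : Defn (fun R v => R (v i) (v j)) := by
  have h1 : Defn (fun R v => v i < v j ∧ R (v i) (v j)) := by
    refine ⟨fF (fand (fat j) (fand (.atom 0 i) (.atom 1 i))), fun L Pi cur v hL hc hf => ?_⟩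
    simp [free_F, free_and, free_at, HQC.free] at hf
    simp only [sat_F, sat_and, sat_atom0 hL hf.2, sat_at hL hf.1]
    have e : ∀ k, S L Pi cur k (.atom 1 i) ↔ 1 ∈ L (node (v i) k) := fun k => by
      simp only [S, HQC.Sat, hf.2]
    simp only [e]
    constructor
    · rintro ⟨k, _, rfl, h2, h3⟩; exact ⟨h2, Or.inl ⟨h2, h3⟩⟩
    · rintro ⟨h1, h2 | h2⟩
      · exact ⟨v j, by omega, rfl, h2⟩
      · omega
  have h2 : Defn (fun R v => v j ≤ v i ∧ R (v i) (v j)) := by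
    refine ⟨fF (fand (fat i) (.next (fand (.atom 0 j) (.atom 2 j)))),
      fun L Pi cur v hL hc hf => ?_⟩
    simp [free_F, free_and, free_at, HQC.free] at hf
    have e : ∀ k, S L Pi cur k (.next (fand (.atom 0 j) (.atom 2 j))) ↔
        v j < k + 1 ∧ 2 ∈ L (node (v j) (k + 1)) := fun k => by
      rw [← sat_atom0 (cur := cur) hL hf.2]
      have : 2 ∈ L (node (v j) (k + 1)) ↔ S L Pi cur (k + 1) (.atom 2 j) := by
        simp only [S, HQC.Sat, hf.2]
      rw [this, ← sat_and]; rfl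
    simp only [sat_F, sat_and, e, sat_at hL hf.1]
    constructor
    · rintro ⟨k, _, rfl, h2, h3⟩; exact ⟨by omega, Or.inr ⟨by omega, h3⟩⟩
    · rintro ⟨h1, h2 | h2⟩
      · omega
      · exact ⟨v i, by omega, rfl, by omega, h2.2⟩
  refine (h1.or h2).congr (fun R v => ?_)
  have := Nat.lt_or_ge (v i) (v j)
  tauto

/-! Recursion -/

def RecG (B : ℕ → ℕ → Prop) (T : ℕ → ℕ → ℕ → ℕ → Prop) (p : ℕ) : ℕ → ℕ → Prop
  | 0, u => B p u
  | k + 1, w => ∃ u, RecG B T p k u ∧ T p k u w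

def D2 (A : ℕ → ℕ → Prop) : Prop := ∀ i j, Defn (fun _ v => A (v i) (v j))
def D3 (A : ℕ → ℕ → ℕ → Prop) : Prop := ∀ i j k, Defn (fun _ v => A (v i) (v j) (v k))
def D4 (A : ℕ → ℕ → ℕ → ℕ → Prop) : Prop :=
  ∀ i j k l, Defn (fun _ v => A (v i) (v j) (v k) (v l))

theorem recG_iff (B : ℕ → ℕ → Prop) (T : ℕ → ℕ → ℕ → ℕ → Prop) (p n y : ℕ) :
    RecG B T p n y ↔ ∃ R : Rel, (∀ z, z = 0 → ∀ u, R z u → B p u) ∧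
      (∀ k, ∀ k', k' = k + 1 → ∀ w, R k' w → ∃ u, R k u ∧ T p k u w) ∧ R n y := by
  constructor
  · intro h
    refine ⟨RecG B T p, ?_, ?_, h⟩
    · rintro _ rfl u h; exact h
    · rintro k _ rfl w h; exact h
  · rintro ⟨R, h0, hs, h⟩
    induction n generalizing y with
    | zero => exact h0 0 rfl _ h
    | succ n ih =>
      obtain ⟨u, hu, ht⟩ := hs n _ rfl _ h
      exact ⟨u, ih _ hu, ht⟩

theorem d_rec {B T} (hB : D2 B) (hT : D4 T) : D3 (RecG B T) := by
  intro i j l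
  let N := i + j + l + 1
  have upd : ∀ (a d : ℕ) (v : ℕ → ℕ) (n : ℕ), a < N + d → Function.update v (N + d) n a = v a := by
    intro a d v n h
    exact Function.update_of_ne (by omega) _ _
  have hi : i < N := by omega
  have hj : j < N := by omega
  have hl : l < N := by omega
  have h1 : Defn (fun R v => ∀ z, z = 0 → ∀ u, R z u → B (v i) u) := by
    refine Defn.allF (fun R p z => z = 0 → ∀ u, R z u → B p u) (fun v => v i) (N + 0)
      (fun v n => upd _ _ _ _ (by omega)) ((d_zero _).imp ?_)
    refine Defn.allF (fun R (p : ℕ × ℕ) u => R p.1 u → B p.2 u) (fun v => (v (N + 0), v i)) (N + 1)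
      (fun v n => ?_) ((d_rel _ _).imp (hB _ _))
    rw [upd i 1 v n (by omega), upd (N + 0) 1 v n (by omega)]
  have h2 : Defn (fun R v => ∀ k, ∀ k', k' = k + 1 → ∀ w, R k' w →
      ∃ u, R k u ∧ T (v i) k u w) := by
    refine Defn.allF (fun R p k => ∀ k', k' = k + 1 → ∀ w, R k' w → ∃ u, R k u ∧ T p k u w)
      (fun v => v i) (N + 0) (fun v n => upd _ _ _ _ (by omega)) ?_
    refine Defn.allF (fun R (p : ℕ × ℕ) k' => k' = p.2 + 1 → ∀ w, R k' w →
      ∃ u, R p.2 u ∧ T p.1 p.2 u w)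
      (fun v => (v i, v (N + 0))) (N + 1) (fun v n => ?_) ((d_succ _ _).imp ?_)
    · rw [upd i 1 v n (by omega), upd (N + 0) 1 v n (by omega)]
    refine Defn.allF (fun R (p : ℕ × ℕ × ℕ) w => R p.2.2 w → ∃ u, R p.2.1 u ∧ T p.1 p.2.1 u w)
      (fun v => (v i, v (N + 0), v (N + 1))) (N + 2) (fun v n => ?_) ((d_rel _ _).imp ?_)
    · rw [upd i 2 v n (by omega), upd (N + 0) 2 v n (by omega), upd (N + 1) 2 v n (by omega)]
    refine Defn.exF (fun R (p : ℕ × ℕ × ℕ) u => R p.2.1 u ∧ T p.1 p.2.1 u p.2.2)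
      (fun v => (v i, v (N + 0), v (N + 2))) (N + 3) (fun v n => ?_) ((d_rel _ _).and (hT _ _ _ _))
    rw [upd i 3 v n (by omega), upd (N + 0) 3 v n (by omega), upd (N + 2) 3 v n (by omega)]
  exact (h1.and (h2.and (d_rel j l))).rex.congr (fun R v => (recG_iff B T _ _ _).symm)

/-- existential quantification with at most five parameters -/
theorem ex5 (A : ℕ → ℕ → ℕ → ℕ → ℕ → ℕ → Prop) (a b c d e : ℕ)
    (h : ∀ k, Defn (fun _ v => A (v a) (v b) (v c) (v d) (v e) (v k))) :
    Defn (fun _ v => ∃ n, A (v a) (v b) (v c) (v d) (v e) n) := by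
  refine (Defn.ex (a + b + c + d + e + 1) (h (a + b + c + d + e + 1))).congr (fun R v => ?_)
  rw [iff_iff_eq]
  congr 1
  funext n
  rw [Function.update_of_ne (by omega), Function.update_of_ne (by omega),
    Function.update_of_ne (by omega), Function.update_of_ne (by omega),
    Function.update_of_ne (by omega), Function.update_self]

theorem ex2 (A : ℕ → ℕ → ℕ → Prop) (a b : ℕ)
    (h : ∀ k, Defn (fun _ v => A (v a) (v b) (v k))) :
    Defn (fun _ v => ∃ n, A (v a) (v b) n) :=
  ex5 (fun a b _ _ _ n => A a b n) a b b b b h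

theorem ex3 (A : ℕ → ℕ → ℕ → ℕ → Prop) (a b c : ℕ)
    (h : ∀ k, Defn (fun _ v => A (v a) (v b) (v c) (v k))) :
    Defn (fun _ v => ∃ n, A (v a) (v b) (v c) n) :=
  ex5 (fun a b c _ _ n => A a b c n) a b c c c h

theorem ex4 (A : ℕ → ℕ → ℕ → ℕ → ℕ → Prop) (a b c d : ℕ)
    (h : ∀ k, Defn (fun _ v => A (v a) (v b) (v c) (v d) (v k))) :
    Defn (fun _ v => ∃ n, A (v a) (v b) (v c) (v d) n) :=
  ex5 (fun a b c d _ n => A a b c d n) a b c d d h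

theorem all2 (A : ℕ → ℕ → ℕ → Prop) (a b : ℕ)
    (h : ∀ k, Defn (fun _ v => A (v a) (v b) (v k))) :
    Defn (fun _ v => ∀ n, A (v a) (v b) n) :=
  (ex2 (fun a b n => ¬ A a b n) a b (fun k => (h k).not)).not.congr
    (fun _ v => by push Not; rfl)

theorem d_add : D3 (fun a b c => c = a + b) := by
  have h : D3 (RecG (fun p u => u = p) (fun _ _ u w => w = u + 1)) :=
    d_rec (fun i j => d_eq j i) (fun _ _ k l => d_succ k l)
  have e : ∀ a b c, RecG (fun p u => u = p) (fun _ _ u w => w = u + 1) a b c ↔ c = a + b := by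
    intro a b
    induction b with
    | zero => intro c; simp [RecG]
    | succ b ih => intro c; simp [RecG, ih]; omega
  exact fun i j k => (h i j k).congr (fun _ v => e _ _ _)

theorem d_mul : D3 (fun a b c => c = a * b) := by
  have h : D3 (RecG (fun _ u => u = 0) (fun p _ u w => w = u + p)) :=
    d_rec (fun _ j => d_zero j) (fun i _ k l => d_add k i l)
  have e : ∀ a b c, RecG (fun _ u => u = 0) (fun p _ u w => w = u + p) a b c ↔ c = a * b := by
    intro a b
    induction b with
    | zero => intro c; simp [RecG]
    | succ b ih => intro c; simp [RecG, ih, Nat.mul_succ]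
  exact fun i j k => (h i j k).congr (fun _ v => e _ _ _)

theorem d_pair : D3 (fun a b c => c = Nat.pair a b) := by
  intro i j k
  have h1 : Defn (fun _ v => v i < v j ∧ ∃ s, s = v j * v j ∧ v k = s + v i) :=
    (d_lt i j).and (ex3 (fun a b c s => s = b * b ∧ c = s + a) i j k
      (fun l => (d_mul j j l).and (d_add l i k)))
  have h2 : Defn (fun _ v => ¬ v i < v j ∧ ∃ s, s = v i * v i ∧ ∃ t, t = s + v i ∧ v k = t + v j) :=
    (d_lt i j).not.and (ex3 (fun a b c s => s = a * a ∧ ∃ t, t = s + a ∧ c = t + b) i j k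
      (fun l => (d_mul i i l).and (ex4 (fun a b c s t => t = s + a ∧ c = t + b) i j k l
        (fun m => (d_add l i m).and (d_add m j k)))))
  refine (h1.or h2).congr (fun _ v => ?_)
  unfold Nat.pair
  by_cases h : v i < v j <;> simp [h]

def DG (f : ℕ →. ℕ) : Prop := D2 (fun x y => y ∈ f x)

/-- membership at a paired argument -/
theorem d_app {f : ℕ →. ℕ} (h : DG f) : D3 (fun a b y => y ∈ f (Nat.pair a b)) := by
  intro i j k
  refine (ex3 (fun a b y p => p = Nat.pair a b ∧ y ∈ f p) i j k
    (fun l => (d_pair i j l).and (h l k))).congr (fun _ v => ?_)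
  simp

theorem dg_partrec {f : ℕ →. ℕ} (hf : Nat.Partrec f) : DG f := by
  induction hf with
  | zero =>
    intro i j
    exact (d_zero j).congr (fun _ v => by simp [pure, PFun.pure])
  | succ =>
    intro i j
    exact (d_succ i j).congr (fun _ v => by simp)
  | left =>
    intro i j
    refine (ex2 (fun x y b => x = Nat.pair y b) i j (fun l => d_pair j l i)).congr (fun _ v => ?_)
    simp only [PFun.coe_val, Part.mem_some_iff]
    constructor
    · rintro ⟨b, h⟩; simp [h]
    · intro h; exact ⟨(Nat.unpair (v i)).2, by simp [h]⟩
  | right =>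
    intro i j
    refine (ex2 (fun x y b => x = Nat.pair b y) i j (fun l => d_pair l j i)).congr (fun _ v => ?_)
    simp only [PFun.coe_val, Part.mem_some_iff]
    constructor
    · rintro ⟨b, h⟩; simp [h]
    · intro h; exact ⟨(Nat.unpair (v i)).1, by simp [h]⟩
  | @pair f g _ _ ihf ihg =>
    intro i j
    refine (ex2 (fun x y a => a ∈ f x ∧ ∃ b, b ∈ g x ∧ y = Nat.pair a b) i j
      (fun l => (ihf i l).and (ex3 (fun x y a b => b ∈ g x ∧ y = Nat.pair a b) i j l
        (fun m => (ihg i m).and (d_pair l m j))))).congr (fun _ v => ?_)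
    simp [Seq.seq, eq_comm]
  | @comp f g _ _ ihf ihg =>
    intro i j
    refine (ex2 (fun x y a => a ∈ g x ∧ y ∈ f a) i j
      (fun l => (ihg i l).and (ihf l j))).congr (fun _ v => ?_)
    exact Part.mem_bind_iff.symm
  | @prec f g _ _ ihf ihg =>
    have hT : D4 (fun p k u w => w ∈ g (Nat.pair p (Nat.pair k u))) := by
      intro i j k l
      refine (ex4 (fun p k u w q => q = Nat.pair k u ∧ w ∈ g (Nat.pair p q)) i j k l
        (fun m => (d_pair j k m).and (d_app ihg i m l))).congr (fun _ v => ?_)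
      simp
    have hR := d_rec ihf hT
    intro i j
    refine (ex2 (fun x y a => ∃ n, x = Nat.pair a n ∧ RecG (fun x y => y ∈ f x)
      (fun p k u w => w ∈ g (Nat.pair p (Nat.pair k u))) a n y) i j (fun l =>
      ex3 (fun x y a n => x = Nat.pair a n ∧ RecG (fun x y => y ∈ f x)
      (fun p k u w => w ∈ g (Nat.pair p (Nat.pair k u))) a n y) i j l (fun m =>
        (d_pair l m i).and (hR l m j)))).congr (fun _ v => ?_)
    have e : ∀ a n y, RecG (fun x y => y ∈ f x)
        (fun p k u w => w ∈ g (Nat.pair p (Nat.pair k u))) a n y ↔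
        y ∈ (Nat.rec (f a) (fun y IH => IH.bind fun i => g (Nat.pair a (Nat.pair y i))) n :
          Part ℕ) := by
      intro a n
      induction n with
      | zero => intro y; rfl
      | succ n ih => intro y; simp [RecG, ih]
    simp only [e]
    constructor
    · rintro ⟨a, n, h, h'⟩
      simp only [h, Nat.unpaired, Nat.unpair_pair]
      exact h'
    · intro h
      exact ⟨(Nat.unpair (v i)).1, (Nat.unpair (v i)).2, by simp, h⟩
  | @rfind f _ ih =>
    intro i j
    have h0 : Defn (fun _ v => ∃ z, z = 0 ∧ z ∈ f (Nat.pair (v i) (v j))) :=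
      ex2 (fun a y z => z = 0 ∧ z ∈ f (Nat.pair a y)) i j
        (fun l => (d_zero l).and (d_app ih i j l))
    have h1 : Defn (fun _ v => ∀ m, m < v j → ∃ w, w ∈ f (Nat.pair (v i) m) ∧ ¬ w = 0) :=
      all2 (fun a y m => m < y → ∃ w, w ∈ f (Nat.pair a m) ∧ ¬ w = 0) i j
        (fun l => (d_lt l j).imp (ex2 (fun a m w => w ∈ f (Nat.pair a m) ∧ ¬ w = 0) i l
          (fun m => (d_app ih i l m).and (d_zero m).not)))
    refine (h0.and h1).congr (fun _ v => ?_)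
    refine Iff.trans ?_ Nat.mem_rfind.symm
    simp

/-! Closing a formula -/

theorem close {φ : HQC} {Q : ℕ → Prop} (h : Defines φ (fun _ v => Q (v 0))) (s : Finset ℕ)
    (hs : 0 ∉ s) : ∃ ψ, ψ.free = φ.free \ s ∧ Defines ψ (fun _ v => Q (v 0)) := by
  induction s using Finset.induction_on with
  | empty => exact ⟨φ, by simp, h⟩
  | insert a s ha ih =>
    simp at hs
    obtain ⟨ψ, hf, hψ⟩ := ih hs.2
    refine ⟨fex a ψ, ?_, ?_⟩
    · rw [free_fex, hf]; ext; simp; tauto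
    · have := defines_ex a hψ
      simpa [Function.update_of_ne hs.1] using this

theorem guarded_true (φ : HQC) : φ.Guarded true := by
  induction φ <;> simp_all [HQC.Guarded]

def nextN (n : ℕ) (φ : HQC) : HQC := HQC.next^[n] φ

theorem sat_nextN {L Pi cur} (n i : ℕ) (φ : HQC) :
    S L Pi cur i (nextN n φ) ↔ S L Pi cur (i + n) φ := by
  induction n generalizing i with
  | zero => rfl
  | succ n ih =>
    have : nextN (n + 1) φ = .next (nextN n φ) := Function.iterate_succ_apply' _ _ _
    rw [this]
    refine Iff.trans (ih (i + 1)) ?_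
    rw [show i + 1 + n = i + (n + 1) by omega]

theorem free_nextN (n : ℕ) (φ : HQC) : (nextN n φ).free = φ.free := by
  induction n with
  | zero => rfl
  | succ n ih =>
    have : nextN (n + 1) φ = .next (nextN n φ) := Function.iterate_succ_apply' _ _ _
    rw [this, ← ih]; rfl

theorem enc_nextN (n : ℕ) (φ : HQC) : (nextN n φ).enc = (Nat.pair 3)^[n] φ.enc := by
  induction n with
  | zero => rfl
  | succ n ih =>
    have : nextN (n + 1) φ = .next (nextN n φ) := Function.iterate_succ_apply' _ _ _
    rw [this, Function.iterate_succ_apply', ← ih]; rfl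

theorem good_init : Good K0.seqLabel := by
  intro p i
  have : ((List.range (i + 1)).map p).getLast? = some (p i) := by
    simp [List.range_succ]
  unfold FinKripke.seqLabel
  rw [this]
  show 0 ∈ ((if p i = 1 then ({0} : Finset ℕ) else ∅ : Finset ℕ) : Set ℕ) ↔ _
  split <;> simp_all

def sent (φ : HQC) (m : ℕ) : HQC := fex 0 (fand (nextN m (fat 0)) φ)

theorem defines_num (m : ℕ) : Defines (nextN m (fat 0)) (fun _ v => v 0 = m) := by
  intro L Pi cur v hL hc hf
  simp [free_nextN, free_at] at hf
  rw [sat_nextN, sat_at hL hf]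
  omega

theorem main_red {Q : ℕ → Prop} (h : Defn (fun _ v => Q (v 0))) :
    ∃ φ : HQC, ∀ m, (sent φ m).Sentence ∧ (K0.Models (sent φ m) ↔ Q m) := by
  obtain ⟨φ, h⟩ := h
  obtain ⟨ψ, hf, hψ⟩ := close h (φ.free.erase 0) (by simp)
  have hfree : ∀ m, (sent ψ m).free = ∅ := by
    intro m
    ext i
    simp [sent, free_fex, free_and, free_nextN, free_at, hf]
    tauto
  refine ⟨ψ, fun m => ⟨⟨hfree m, guarded_true _⟩, ?_⟩⟩
  have hd := defines_ex 0 (defines_and (defines_num m) hψ)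
  refine (hd K0.seqLabel _ _ (fun _ => 0) good_init rfl ?_).trans ?_
  · intro i hi
    have := hfree m
    unfold sent at this
    rw [this] at hi
    simp at hi
  · simp

theorem enc_sent_computable (φ : HQC) : Computable (fun m => (sent φ m).enc) := by
  have h : Primrec (fun m : ℕ => (Nat.pair 3)^[m] (fat 0).enc) :=
    Primrec.nat_iterate Primrec.id (Primrec.const _)
      (Primrec₂.natPair.comp (Primrec.const 3) Primrec.snd)
  have e : (fun m => (sent φ m).enc) = fun m =>
      Nat.pair 5 (Nat.pair 0 (Nat.pair 1 (Nat.pair 2 (Nat.pair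
        (Nat.pair 1 (fF (.atom 0 0)).enc)
        (Nat.pair 1 (Nat.pair 1 (Nat.pair 2 (Nat.pair
          (Nat.pair 1 ((Nat.pair 3)^[m] (fat 0).enc)) (Nat.pair 1 φ.enc))))))))) := by
    funext m
    rw [← enc_nextN]
    rfl
  rw [e]
  have c : ∀ (a : ℕ) {g : ℕ → ℕ}, Primrec g → Primrec (fun m => Nat.pair a (g m)) :=
    fun a g hg => Primrec₂.natPair.comp (Primrec.const a) hg
  refine Primrec.to_comp ?_
  exact c _ (c _ (c _ (c _ (c _ (c _ (c _ (c _ (Primrec₂.natPair.comp (c _ h)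
    (Primrec.const _)))))))))

end HQCU

/-- **The HyperQCTL* model checking problem is undecidable**: there is no
computable (total) function that, given (the encoding of) a finite Kripke
structure `K` and a HyperQCTL* sentence `φ`, decides whether `K ⊨ φ`. -/
theorem hyperQCTLstar_model_checking_undecidable :
    ¬ ∃ f : ℕ → Bool, Computable f ∧
        ∀ (K : FinKripke) (φ : HQC), φ.Sentence →
          (f (Nat.pair K.enc φ.enc) = true ↔ K.Models φ) := by
  rintro ⟨f, hf, hdec⟩
  have hpr : Partrec (fun m : ℕ => (Denumerable.ofNat Nat.Partrec.Code m).eval 0) :=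
    Nat.Partrec.Code.eval_part.comp (Computable.ofNat _) (Computable.const 0)
  have hdg := HQCU.dg_partrec (Partrec.nat_iff.1 hpr)
  obtain ⟨φ, hφ⟩ := HQCU.main_red
    (Q := fun m => ∃ y, y ∈ (Denumerable.ofNat Nat.Partrec.Code m).eval 0)
    (HQCU.ex2 (fun x _ y => y ∈ (Denumerable.ofNat Nat.Partrec.Code x).eval 0) 0 0
      (fun l => hdg 0 l))
  apply ComputablePred.halting_problem 0
  rw [ComputablePred.computable_iff]
  refine ⟨fun c => f (Nat.pair HQCU.K0.enc (HQCU.sent φ (Encodable.encode c)).enc), ?_, ?_⟩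
  · exact hf.comp (Primrec₂.natPair.to_comp.comp (Computable.const _)
      ((HQCU.enc_sent_computable φ).comp Computable.encode))
  · funext c
    apply propext
    rw [hdec _ _ (hφ _).1, (hφ _).2]
    simp [Part.dom_iff_mem]
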